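/- Let E_n denote the OEDG solution operator for the linear advection equation with upwind flux, i.e., E_n(u⁰) = u_σ^n where u_σ^0 = u⁰ ∈ V^k. Since the flux f(u) = βu and the upwind numerical flux are homogeneous, E_n is homogeneous: E_n(λu⁰) = λ E_n(u⁰) for every λ ∈ ℝ, every u⁰ ∈ V^k, and every n ≥ 0. (Theorem 2.2.) -/

import Mathlib

open Polynomial Finset MeasureTheory

namespace OEDG

variable {N : ℕ}

/-- `pt` lists the nodes `x_{1/2} < x_{3/2} < … < x_{N+1/2}` of a partition of `Ω = [0,1]`. -/
def IsMesh (pt : Fin (N+1) → ℝ) : Prop :=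
  pt 0 = 0 ∧ pt (Fin.last N) = 1 ∧ StrictMono pt

/-- Left endpoint of cell `j`. -/
def ptL (pt : Fin (N+1) → ℝ) (j : Fin N) : ℝ := pt j.castSucc

/-- Right endpoint of cell `j`. -/
def ptR (pt : Fin (N+1) → ℝ) (j : Fin N) : ℝ := pt j.succ

/-- Length `h_j` of cell `j`. -/
def cellh (pt : Fin (N+1) → ℝ) (j : Fin N) : ℝ := ptR pt j - ptL pt j

/-- Maximal mesh size `h`. -/
noncomputable def meshSize (pt : Fin (N+1) → ℝ) : ℝ := ⨆ j : Fin N, cellh pt j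

/-- Quasi-uniformity of the partition: `h ≤ γ h_j` for all `j`. -/
def QuasiUniform (pt : Fin (N+1) → ℝ) (γ : ℝ) : Prop :=
  ∀ j : Fin N, meshSize pt ≤ γ * cellh pt j

/-- Membership in `V^k`: every cell polynomial has degree at most `k`. -/
def MemVk (k : ℕ) (u : Fin N → Polynomial ℝ) : Prop :=
  ∀ j, (u j).natDegree ≤ k

/-- Cellwise `L²` inner product. -/
noncomputable def cip (pt : Fin (N+1) → ℝ) (j : Fin N) (p q : Polynomial ℝ) : ℝ :=
  ∫ x in (ptL pt j)..(ptR pt j), p.eval x * q.eval x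

/-- Global `L²(Ω)` inner product of piecewise polynomials. -/
noncomputable def ip (pt : Fin (N+1) → ℝ) (u v : Fin N → Polynomial ℝ) : ℝ :=
  ∑ j : Fin N, cip pt j (u j) (v j)

/-- Cellwise `L²` norm. -/
noncomputable def cl2 (pt : Fin (N+1) → ℝ) (j : Fin N) (p : Polynomial ℝ) : ℝ :=
  Real.sqrt (cip pt j p p)

/-- Global `L²(Ω)` norm of a piecewise polynomial. -/
noncomputable def l2 (pt : Fin (N+1) → ℝ) (u : Fin N → Polynomial ℝ) : ℝ :=
  Real.sqrt (ip pt u u)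

/-- Average `avg(u) = (1/|Ω|) ∫_Ω u dx` (here `|Ω| = 1`). -/
noncomputable def avg (pt : Fin (N+1) → ℝ) (u : Fin N → Polynomial ℝ) : ℝ :=
  ∑ j : Fin N, ∫ x in (ptL pt j)..(ptR pt j), (u j).eval x

/-- `‖u - c‖_{L∞(Ω)}` for a piecewise polynomial `u` and a constant `c`. -/
noncomputable def linfSub (pt : Fin (N+1) → ℝ) (u : Fin N → Polynomial ℝ) (c : ℝ) : ℝ :=
  ⨆ j : Fin N, sSup ((fun x => |(u j).eval x - c|) '' Set.Icc (ptL pt j) (ptR pt j))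

/-- `m`-th derivative of a polynomial. -/
noncomputable def pderiv (m : ℕ) (p : Polynomial ℝ) : Polynomial ℝ :=
  (fun q : Polynomial ℝ => Polynomial.derivative q)^[m] p

/-- Jump `[∂_x^m u]_{j+1/2}` of the `m`-th derivative at the interface to the right of
cell `j`, with periodic identification of `x_{N+1/2}` with `x_{1/2}`. -/
noncomputable def jumpD [NeZero N] (pt : Fin (N+1) → ℝ) (u : Fin N → Polynomial ℝ)
    (m : ℕ) (j : Fin N) : ℝ :=
  (pderiv m (u (j+1))).eval (pt (Fin.castSucc (j+1))) - (pderiv m (u j)).eval (pt j.succ)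

/-- The scale-invariant damping coefficient `σ_j^m(u)` of the OEDG method. -/
noncomputable def sigma [NeZero N] (k : ℕ) (pt : Fin (N+1) → ℝ)
    (u : Fin N → Polynomial ℝ) (m : ℕ) (j : Fin N) : ℝ :=
  if ∀ i, u i = Polynomial.C (avg pt u) then 0
  else (2*(m:ℝ)+1) * (cellh pt j)^m / ((2*(k:ℝ)-1) * (Nat.factorial m)) *
    ((|jumpD pt u m (j-1)| + |jumpD pt u m j|) / (2 * linfSub pt u (avg pt u)))

/-- Damping rate `δ_j^m = β_j σ_j^m(u) / h_j`. -/
noncomputable def dampRate [NeZero N] (k : ℕ) (pt : Fin (N+1) → ℝ) (β : Fin N → ℝ)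
    (u : Fin N → Polynomial ℝ) (m : ℕ) (j : Fin N) : ℝ :=
  β j * sigma k pt u m j / cellh pt j

/-- `Pc j d` is the cellwise `L²(I_j)`-orthogonal projection onto `ℙ^d(I_j)`.
(The family `Pc` realizes the global projections `P^d` onto `V^d`.) -/
def IsCellProj (pt : Fin (N+1) → ℝ)
    (Pc : Fin N → ℕ → Polynomial ℝ → Polynomial ℝ) : Prop :=
  ∀ (j : Fin N) (dd : ℕ) (p : Polynomial ℝ), (Pc j dd p).natDegree ≤ dd ∧
    ∀ q : Polynomial ℝ, q.natDegree ≤ dd → cip pt j (p - Pc j dd p) q = 0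

/-- `w` solves the damping initial value problem with initial data `u`:
`d/dt̂ ∫_{I_j} u_σ v dx + ∑_{m=0}^k (β_j σ_j^m(u)/h_j) ∫_{I_j} (u_σ - P^{m-1} u_σ) v dx = 0`
for every `v ∈ ℙ^k(I_j)` and every `j`, with `u_σ(·,0) = u`.  (Note `m - 1` is
truncated ℕ-subtraction, which realizes the convention `P^{-1} = P^0`.) -/
def IsDampingSol [NeZero N] (k : ℕ) (pt : Fin (N+1) → ℝ) (β : Fin N → ℝ)
    (Pc : Fin N → ℕ → Polynomial ℝ → Polynomial ℝ)
    (u : Fin N → Polynomial ℝ) (w : ℝ → Fin N → Polynomial ℝ) : Prop :=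
  w 0 = u ∧ (∀ t j, (w t j).natDegree ≤ k) ∧
  ∀ (t : ℝ) (j : Fin N) (v : Polynomial ℝ), v.natDegree ≤ k →
    HasDerivAt (fun s => cip pt j (w s j) v)
      (-(∑ m ∈ Finset.range (k+1),
        dampRate k pt β u m j * cip pt j (w t j - Pc j (m-1) (w t j)) v)) t

/-- `Fτ` is the OE (oscillation-eliminating) operator: for every `u ∈ V^k` the damping
initial value problem has a solution `w` and `Fτ u = w τ`. -/
def IsOEOp [NeZero N] (k : ℕ) (pt : Fin (N+1) → ℝ) (β : Fin N → ℝ)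
    (Pc : Fin N → ℕ → Polynomial ℝ → Polynomial ℝ) (τ : ℝ)
    (Fτ : (Fin N → Polynomial ℝ) → (Fin N → Polynomial ℝ)) : Prop :=
  ∀ u, MemVk k u → ∃ w, IsDampingSol k pt β Pc u w ∧ Fτ u = w τ

/-- Right-hand side of the weak form of the upwind DG operator for `u_t + β u_x = 0`:
`β ∫_{I_j} w v_x dx - β w(x_{j+1/2}^-) v(x_{j+1/2}^-) + β w(x_{j-1/2}^-) v(x_{j-1/2}^+)`. -/
noncomputable def dgRHS [NeZero N] (pt : Fin (N+1) → ℝ) (β : ℝ)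
    (w : Fin N → Polynomial ℝ) (j : Fin N) (v : Polynomial ℝ) : ℝ :=
  β * (∫ x in (ptL pt j)..(ptR pt j), (w j).eval x * (Polynomial.derivative v).eval x)
  - β * (w j).eval (ptR pt j) * v.eval (ptR pt j)
  + β * (w (j-1)).eval (pt (j-1).succ) * v.eval (ptL pt j)

/-- `L` is the upwind DG spatial operator on `V^k`. -/
def IsDGOp [NeZero N] (k : ℕ) (pt : Fin (N+1) → ℝ) (β : ℝ)
    (L : (Fin N → Polynomial ℝ) → (Fin N → Polynomial ℝ)) : Prop :=
  ∀ w, MemVk k w → MemVk k (L w) ∧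
    ∀ (j : Fin N) (v : Polynomial ℝ), v.natDegree ≤ k →
      cip pt j (L w j) v = dgRHS pt β w j v

/-- The upwind DG bilinear form
`H(w,v) = β ∑_j ∫_{I_j} w v_x dx + β ∑_j w(x_{j+1/2}^-) [v]_{j+1/2}`. -/
noncomputable def Hform [NeZero N] (pt : Fin (N+1) → ℝ) (β : ℝ)
    (w v : Fin N → Polynomial ℝ) : ℝ :=
  β * ∑ j : Fin N, (∫ x in (ptL pt j)..(ptR pt j),
      (w j).eval x * (Polynomial.derivative (v j)).eval x)
  + β * ∑ j : Fin N, (w j).eval (ptR pt j) * jumpD pt v 0 j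

/-- The upwind DG bilinear form with piecewise-smooth first argument. -/
noncomputable def HformF [NeZero N] (pt : Fin (N+1) → ℝ) (β : ℝ)
    (w : Fin N → ℝ → ℝ) (v : Fin N → Polynomial ℝ) : ℝ :=
  β * ∑ j : Fin N, (∫ x in (ptL pt j)..(ptR pt j),
      w j x * (Polynomial.derivative (v j)).eval x)
  + β * ∑ j : Fin N, w j (ptR pt j) * jumpD pt v 0 j

/-- `L²(Ω)` pairing of a piecewise-smooth function with a piecewise polynomial. -/
noncomputable def ipF (pt : Fin (N+1) → ℝ) (w : Fin N → ℝ → ℝ)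
    (v : Fin N → Polynomial ℝ) : ℝ :=
  ∑ j : Fin N, ∫ x in (ptL pt j)..(ptR pt j), w j x * (v j).eval x

/-- One Runge–Kutta stage: `∑_{0≤m≤ℓ} (c_{ℓm} u_σ^{n,m} + τ d_{ℓm} L(u_σ^{n,m}))`. -/
noncomputable def rkStage [NeZero N] (c d : ℕ → ℕ → ℝ) (τ : ℝ)
    (L : (Fin N → Polynomial ℝ) → (Fin N → Polynomial ℝ))
    (uσ : ℕ → Fin N → Polynomial ℝ) (ℓ : ℕ) : Fin N → Polynomial ℝ :=
  fun j => ∑ m ∈ Finset.range (ℓ+1),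
    (Polynomial.C (c ℓ m) * uσ m j + Polynomial.C (τ * d ℓ m) * L (uσ m) j)

/-- One full OEDG time step from `u_σ^n = un`: the stages `u_h^{n,ℓ+1}` and
`u_σ^{n,ℓ+1} = F_τ u_h^{n,ℓ+1}`, `0 ≤ ℓ ≤ s-1`. -/
def IsOEDGStep [NeZero N] (s : ℕ) (c d : ℕ → ℕ → ℝ) (τ : ℝ)
    (L Fτ : (Fin N → Polynomial ℝ) → (Fin N → Polynomial ℝ))
    (un : Fin N → Polynomial ℝ) (uh uσ : ℕ → Fin N → Polynomial ℝ) : Prop :=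
  uσ 0 = un ∧ ∀ ℓ < s, uh (ℓ+1) = rkStage c d τ L uσ ℓ ∧ uσ (ℓ+1) = Fτ (uh (ℓ+1))

/-- The full OEDG evolution: `uσ n ℓ = u_σ^{n,ℓ}` and `uh n ℓ = u_h^{n,ℓ}`, starting from
`u_σ^0 = u0`, with `u_σ^{n+1} = u_σ^{n,s}`. -/
def IsOEDGEvol [NeZero N] (s : ℕ) (c d : ℕ → ℕ → ℝ) (τ : ℝ)
    (L Fτ : (Fin N → Polynomial ℝ) → (Fin N → Polynomial ℝ))
    (u0 : Fin N → Polynomial ℝ) (uh uσ : ℕ → ℕ → Fin N → Polynomial ℝ) : Prop :=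
  uσ 0 0 = u0 ∧ ∀ n, uσ (n+1) 0 = uσ n s ∧
    ∀ ℓ < s, uh n (ℓ+1) = rkStage c d τ L (uσ n) ℓ ∧ uσ n (ℓ+1) = Fτ (uh n (ℓ+1))

/-- `p` is the Gauss–Radau projection of `w` on `[a,b]` into `ℙ^k`:
`∫_a^b (w - p) q dx = 0` for all `q ∈ ℙ^{k-1}` and `p(b) = w(b)`. -/
def IsGRProj (k : ℕ) (a b : ℝ) (w : ℝ → ℝ) (p : Polynomial ℝ) : Prop :=
  p.natDegree ≤ k ∧
  (∀ q : Polynomial ℝ, q.natDegree < k →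
    (∫ x in a..b, (w x - p.eval x) * q.eval x) = 0) ∧
  p.eval b = w b

/-- `u = u(x,t)` is a smooth `1`-periodic exact solution of `u_t + β u_x = 0`. -/
def IsSmoothSolution (β : ℝ) (u : ℝ → ℝ → ℝ) : Prop :=
  ContDiff ℝ (⊤ : ℕ∞) (fun p : ℝ × ℝ => u p.1 p.2) ∧
  (∀ x t, u (x+1) t = u x t) ∧
  (∀ x t, deriv (fun s => u x s) t + β * deriv (fun y => u y t) x = 0)

/-- Auxiliary table for the reference functions `U^{n,ℓ}`. -/
noncomputable def UrefUpTo (u : ℝ → ℝ → ℝ) (c d : ℕ → ℕ → ℝ) (β τ : ℝ) (n : ℕ) :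
    ℕ → ℕ → ℝ → ℝ
  | 0 => fun _ => fun x => u x ((n:ℝ) * τ)
  | (ℓ+1) => fun i =>
      if i ≤ ℓ then UrefUpTo u c d β τ n ℓ i
      else fun x => ∑ m ∈ Finset.range (ℓ+1),
        (c ℓ m * UrefUpTo u c d β τ n ℓ m x
          - τ * d ℓ m * β * deriv (UrefUpTo u c d β τ n ℓ m) x)

/-- Reference function `U^{n,ℓ}` (for `0 ≤ ℓ ≤ s-1`): `U^{n,0} = u(·, t^n)` and
`U^{n,ℓ+1} = ∑_{0≤m≤ℓ} (c_{ℓm} U^{n,m} - τ d_{ℓm} β ∂_x U^{n,m})`. -/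
noncomputable def Uref (u : ℝ → ℝ → ℝ) (c d : ℕ → ℕ → ℝ) (β τ : ℝ) (n ℓ : ℕ) : ℝ → ℝ :=
  UrefUpTo u c d β τ n ℓ ℓ

/-- Reference function `U^{n,ℓ}` including the final stage `U^{n,s} := u(·, t^{n+1})`. -/
noncomputable def UrefS (u : ℝ → ℝ → ℝ) (c d : ℕ → ℕ → ℝ) (β τ : ℝ) (s n ℓ : ℕ) : ℝ → ℝ :=
  if ℓ = s then fun x => u x (((n:ℝ)+1) * τ) else Uref u c d β τ n ℓ

/-- The Runge–Kutta residual `ρ^{n,s-1}`, defined so that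
`U^{n,s} = ∑_{0≤m≤s-1} (c_{s-1,m} U^{n,m} - τ d_{s-1,m} β ∂_x U^{n,m}) + τ ρ^{n,s-1}`. -/
noncomputable def rkRes (u : ℝ → ℝ → ℝ) (c d : ℕ → ℕ → ℝ) (β τ : ℝ) (s n : ℕ) : ℝ → ℝ :=
  fun x => (u x (((n:ℝ)+1) * τ) - ∑ m ∈ Finset.range s,
    (c (s-1) m * Uref u c d β τ n m x
      - τ * d (s-1) m * β * deriv (Uref u c d β τ n m) x)) / τ

/-- `L²(0,1)` norm of a function. -/
noncomputable def fl2 (f : ℝ → ℝ) : ℝ := Real.sqrt (∫ x in (0:ℝ)..1, (f x)^2)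

/-- `L²(Ω)` distance between a piecewise polynomial and a function. -/
noncomputable def errL2 (pt : Fin (N+1) → ℝ) (w : Fin N → Polynomial ℝ) (f : ℝ → ℝ) : ℝ :=
  Real.sqrt (∑ j : Fin N, ∫ x in (ptL pt j)..(ptR pt j), ((w j).eval x - f x)^2)


/-! ### The cellwise inner product -/

lemma ptL_lt_ptR {pt : Fin (N+1) → ℝ} (hpt : IsMesh pt) (j : Fin N) : ptL pt j < ptR pt j :=
  hpt.2.2 Fin.castSucc_lt_succ

lemma cip_comm (pt : Fin (N+1) → ℝ) (j : Fin N) (p q : Polynomial ℝ) :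
    cip pt j p q = cip pt j q p := by
  simp only [cip, mul_comm]

lemma cip_sub_left (pt : Fin (N+1) → ℝ) (j : Fin N) (p q v : Polynomial ℝ) :
    cip pt j (p - q) v = cip pt j p v - cip pt j q v := by
  unfold cip
  rw [← intervalIntegral.integral_sub]
  · simp only [eval_sub, sub_mul]
  all_goals exact Continuous.intervalIntegrable (by fun_prop) _ _

lemma cip_sub_right (pt : Fin (N+1) → ℝ) (j : Fin N) (p q v : Polynomial ℝ) :
    cip pt j v (p - q) = cip pt j v p - cip pt j v q := by
  simp only [cip_comm pt j v, cip_sub_left]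

lemma cip_C_mul_left (pt : Fin (N+1) → ℝ) (j : Fin N) (a : ℝ) (p v : Polynomial ℝ) :
    cip pt j (C a * p) v = a * cip pt j p v := by
  unfold cip
  rw [← intervalIntegral.integral_const_mul]
  simp only [eval_mul, eval_C, mul_assoc]

lemma eq_zero_of_cip_self {pt : Fin (N+1) → ℝ} (hpt : IsMesh pt) (j : Fin N) {p : Polynomial ℝ}
    (h : cip pt j p p = 0) : p = 0 := by
  have hlt := ptL_lt_ptR hpt j
  refine eq_zero_of_infinite_isRoot p ((Set.Icc_infinite hlt).mono fun x hx => ?_)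
  by_contra hne
  have hpos : 0 < cip pt j p p :=
    intervalIntegral.integral_pos hlt (by fun_prop) (fun y _ => mul_self_nonneg _)
      ⟨x, hx, mul_self_pos.2 hne⟩
  exact hpos.ne' h

/-! ### The cellwise projections -/

lemma IsCellProj.eq_self {pt : Fin (N+1) → ℝ} (hpt : IsMesh pt)
    {Pc : Fin N → ℕ → Polynomial ℝ → Polynomial ℝ} (hPc : IsCellProj pt Pc) (j : Fin N) {i : ℕ}
    {p : Polynomial ℝ} (hp : p.natDegree ≤ i) : Pc j i p = p := by
  obtain ⟨hdeg, horth⟩ := hPc j i p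
  have := eq_zero_of_cip_self hpt j (horth _ (natDegree_sub_le_of_le hp hdeg |>.trans (by simp)))
  exact (sub_eq_zero.1 this).symm

lemma IsCellProj.cip_sub_proj {pt : Fin (N+1) → ℝ}
    {Pc : Fin N → ℕ → Polynomial ℝ → Polynomial ℝ} (hPc : IsCellProj pt Pc) (j : Fin N) (i : ℕ)
    (p v : Polynomial ℝ) :
    cip pt j (p - Pc j i p) v = cip pt j p v - cip pt j p (Pc j i v) := by
  have h₁ := (hPc j i p).2 _ (hPc j i v).1
  have h₂ := (hPc j i v).2 _ (hPc j i p).1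
  rw [cip_comm, cip_sub_right] at h₂
  rw [cip_sub_left] at h₁ ⊢
  linarith

/-! ### Uniqueness for the damping problem -/

lemma eq_zero_of_hasDerivAt_const_mul {f : ℝ → ℝ} {a : ℝ} (hf : ∀ t, HasDerivAt f (a * f t) t)
    (h0 : f 0 = 0) (t : ℝ) : f t = 0 := by
  have hg : ∀ t, HasDerivAt (fun t => f t * Real.exp (-a * t)) 0 t := fun t => by
    refine ((hf t).mul (((hasDerivAt_id t).const_mul (-a)).exp)).congr_deriv ?_
    simp only [id]
    ring
  have := is_const_of_deriv_eq_zero (fun t => (hg t).differentiableAt) (fun t => (hg t).deriv) t 0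
  simpa [h0, Real.exp_ne_zero] using this

/-- Only the zero curve solves the linear damping problem with zero initial data, whatever the
rates `r m`. -/
lemma damping_unique {pt : Fin (N+1) → ℝ} (hpt : IsMesh pt)
    {Pc : Fin N → ℕ → Polynomial ℝ → Polynomial ℝ} (hPc : IsCellProj pt Pc) {k : ℕ} (j : Fin N)
    (r : ℕ → ℝ) {e : ℝ → Polynomial ℝ} (h0 : e 0 = 0) (hdeg : ∀ t, (e t).natDegree ≤ k)
    (hder : ∀ (t : ℝ) (v : Polynomial ℝ), v.natDegree ≤ k →
      HasDerivAt (fun s => cip pt j (e s) v)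
        (-(∑ m ∈ Finset.range (k+1), r m * cip pt j (e t - Pc j (m-1) (e t)) v)) t) (t : ℝ) :
    e t = 0 := by
  have key : ∀ i, ∀ v : Polynomial ℝ, v.natDegree ≤ i → v.natDegree ≤ k →
      ∀ t, cip pt j (e t) v = 0 := by
    intro i
    induction i using Nat.strong_induction_on with
    | _ i ih =>
      intro v hvi hvk
      refine eq_zero_of_hasDerivAt_const_mul
        (a := -∑ m ∈ Finset.range (k+1), if i ≤ m - 1 then 0 else r m) (fun t => ?_)
        (by simp [h0, cip])
      convert hder t v hvk using 1
      rw [neg_mul, Finset.sum_mul]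
      congr 1
      refine Finset.sum_congr rfl fun m hm => ?_
      rw [hPc.cip_sub_proj]
      split_ifs with him
      · rw [hPc.eq_self hpt j (hvi.trans him)]
        ring
      · have hm' := Finset.mem_range.1 hm
        have hP := (hPc j (m-1) v).1
        rw [ih (m-1) (by omega) _ hP (by omega), sub_zero]
  exact eq_zero_of_cip_self hpt j (key k _ (hdeg t) (hdeg t) t)

/-! ### Scaling of the damping coefficients -/

lemma avg_C_mul (pt : Fin (N+1) → ℝ) (a : ℝ) (u : Fin N → Polynomial ℝ) :
    avg pt (fun j => C a * u j) = a * avg pt u := by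
  simp only [avg, eval_mul, eval_C, intervalIntegral.integral_const_mul, Finset.mul_sum]

lemma linfSub_C_mul (pt : Fin (N+1) → ℝ) (a c : ℝ) (u : Fin N → Polynomial ℝ) :
    linfSub pt (fun j => C a * u j) (a * c) = |a| * linfSub pt u c := by
  unfold linfSub
  rw [Real.mul_iSup_of_nonneg (abs_nonneg a)]
  congr 1 with j
  rw [← smul_eq_mul |a|, ← Real.sSup_smul_of_nonneg (abs_nonneg a), ← Set.image_smul,
    Set.image_image]
  simp only [eval_mul, eval_C, ← mul_sub, abs_mul, smul_eq_mul]

lemma jumpD_C_mul [NeZero N] (pt : Fin (N+1) → ℝ) (a : ℝ) (u : Fin N → Polynomial ℝ) (m : ℕ)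
    (j : Fin N) : jumpD pt (fun j => C a * u j) m j = a * jumpD pt u m j := by
  have h : ∀ p : Polynomial ℝ, pderiv m (C a * p) = C a * pderiv m p :=
    fun p => iterate_derivative_C_mul a p m
  simp only [jumpD, h, eval_mul, eval_C, mul_sub]

lemma sigma_C_mul [NeZero N] (k : ℕ) (pt : Fin (N+1) → ℝ) {a : ℝ} (ha : a ≠ 0)
    (u : Fin N → Polynomial ℝ) (m : ℕ) (j : Fin N) :
    sigma k pt (fun j => C a * u j) m j = sigma k pt u m j := by
  have hiff : (∀ i, C a * u i = C (a * avg pt u)) ↔ ∀ i, u i = C (avg pt u) := by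
    simp only [C_mul, mul_right_inj' (C_ne_zero.2 ha)]
  simp only [sigma, avg_C_mul, hiff, linfSub_C_mul, jumpD_C_mul, abs_mul, ← mul_add,
    mul_left_comm (2 : ℝ) |a|, mul_div_mul_left _ _ (abs_ne_zero.2 ha)]

/-! ### Homogeneity of the operators -/

lemma MemVk.C_mul {k : ℕ} {u : Fin N → Polynomial ℝ} (hu : MemVk k u) (a : ℝ) :
    MemVk k (fun j => C a * u j) :=
  fun j => (natDegree_C_mul_le a (u j)).trans (hu j)

lemma IsOEOp.memVk [NeZero N] {k : ℕ} {pt : Fin (N+1) → ℝ} {β : Fin N → ℝ}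
    {Pc : Fin N → ℕ → Polynomial ℝ → Polynomial ℝ} {τ : ℝ}
    {Fτ : (Fin N → Polynomial ℝ) → (Fin N → Polynomial ℝ)} (hF : IsOEOp k pt β Pc τ Fτ)
    {u : Fin N → Polynomial ℝ} (hu : MemVk k u) : MemVk k (Fτ u) := by
  obtain ⟨w, ⟨-, hdeg, -⟩, hw⟩ := hF u hu
  exact hw ▸ hdeg τ

lemma IsOEOp.map_C_mul [NeZero N] {k : ℕ} {pt : Fin (N+1) → ℝ} (hpt : IsMesh pt) {β : Fin N → ℝ}
    {Pc : Fin N → ℕ → Polynomial ℝ → Polynomial ℝ} (hPc : IsCellProj pt Pc) {τ : ℝ}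
    {Fτ : (Fin N → Polynomial ℝ) → (Fin N → Polynomial ℝ)} (hF : IsOEOp k pt β Pc τ Fτ)
    {u : Fin N → Polynomial ℝ} (hu : MemVk k u) (a : ℝ) :
    Fτ (fun j => C a * u j) = fun j => C a * Fτ u j := by
  obtain ⟨w, ⟨hw0, hwdeg, hwder⟩, hw⟩ := hF u hu
  obtain ⟨z, ⟨hz0, hzdeg, hzder⟩, hz⟩ := hF _ (hu.C_mul a)
  rw [hw, hz]
  funext j
  have hrate : ∀ m, a * dampRate k pt β (fun j => C a * u j) m j = a * dampRate k pt β u m j := by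
    intro m
    rcases eq_or_ne a 0 with rfl | ha
    · simp
    · simp only [dampRate, sigma_C_mul k pt ha]
  refine sub_eq_zero.1 (damping_unique hpt hPc (k := k) j
    (fun m => dampRate k pt β (fun j => C a * u j) m j) (e := fun t => z t j - C a * w t j)
    (by simp [hw0, hz0]) (fun t => ?_) (fun t v hv => ?_) τ)
  · exact (natDegree_sub_le_of_le (hzdeg t j)
      ((natDegree_C_mul_le _ _).trans (hwdeg t j))).trans (by simp)
  · have hfun : (fun s => cip pt j (z s j - C a * w s j) v) =
        (fun s => cip pt j (z s j) v) - fun s => a * cip pt j (w s j) v := by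
      funext s
      simp [cip_sub_left, cip_C_mul_left]
    have hterm : ∀ m, dampRate k pt β (fun j => C a * u j) m j *
          cip pt j (z t j - C a * w t j - Pc j (m-1) (z t j - C a * w t j)) v =
        dampRate k pt β (fun j => C a * u j) m j * cip pt j (z t j - Pc j (m-1) (z t j)) v -
          a * (dampRate k pt β u m j * cip pt j (w t j - Pc j (m-1) (w t j)) v) := by
      intro m
      simp only [hPc.cip_sub_proj, cip_sub_left, cip_C_mul_left]
      linear_combination
        -(cip pt j (w t j) v - cip pt j (w t j) (Pc j (m-1) v)) * hrate m
    rw [hfun]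
    refine ((hzder t j v hv).sub ((hwder t j v hv).const_mul a)).congr_deriv ?_
    simp only [hterm, Finset.sum_sub_distrib, ← Finset.mul_sum]
    ring

lemma dgRHS_C_mul [NeZero N] (pt : Fin (N+1) → ℝ) (β a : ℝ) (w : Fin N → Polynomial ℝ)
    (j : Fin N) (v : Polynomial ℝ) :
    dgRHS pt β (fun j => C a * w j) j v = a * dgRHS pt β w j v := by
  simp only [dgRHS, eval_mul, eval_C, mul_assoc, intervalIntegral.integral_const_mul]
  ring

lemma IsDGOp.map_C_mul [NeZero N] {k : ℕ} {pt : Fin (N+1) → ℝ} (hpt : IsMesh pt) {β : ℝ}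
    {L : (Fin N → Polynomial ℝ) → (Fin N → Polynomial ℝ)} (hL : IsDGOp k pt β L)
    {w : Fin N → Polynomial ℝ} (hw : MemVk k w) (a : ℝ) :
    L (fun j => C a * w j) = fun j => C a * L w j := by
  funext j
  obtain ⟨hdeg, hLw⟩ := hL w hw
  obtain ⟨hdeg', hLaw⟩ := hL _ (hw.C_mul a)
  have hd : (L (fun j => C a * w j) j - C a * L w j).natDegree ≤ k :=
    (natDegree_sub_le_of_le (hdeg' j) (hdeg.C_mul a j)).trans (by simp)
  refine sub_eq_zero.1 (eq_zero_of_cip_self hpt j ?_)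
  rw [cip_sub_left, cip_C_mul_left, hLaw j _ hd, hLw j _ hd, dgRHS_C_mul, sub_self]

lemma memVk_rkStage [NeZero N] {k : ℕ} {pt : Fin (N+1) → ℝ} {β : ℝ} (c d : ℕ → ℕ → ℝ) (τ : ℝ)
    {L : (Fin N → Polynomial ℝ) → (Fin N → Polynomial ℝ)} (hL : IsDGOp k pt β L)
    {u : ℕ → Fin N → Polynomial ℝ} {ℓ : ℕ} (hu : ∀ m ≤ ℓ, MemVk k (u m)) :
    MemVk k (rkStage c d τ L u ℓ) := by
  intro j
  refine natDegree_sum_le_of_forall_le _ _ fun m hm => ?_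
  have hm' := hu m (Nat.lt_succ_iff.1 (Finset.mem_range.1 hm))
  exact natDegree_add_le_of_degree_le (hm'.C_mul _ j) ((hL _ hm').1.C_mul _ j)

lemma rkStage_C_mul [NeZero N] {k : ℕ} {pt : Fin (N+1) → ℝ} (hpt : IsMesh pt) {β : ℝ}
    (c d : ℕ → ℕ → ℝ) (τ : ℝ)
    {L : (Fin N → Polynomial ℝ) → (Fin N → Polynomial ℝ)} (hL : IsDGOp k pt β L)
    {u u' : ℕ → Fin N → Polynomial ℝ} {ℓ : ℕ} (hu : ∀ m ≤ ℓ, MemVk k (u m)) (a : ℝ)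
    (hu' : ∀ m ≤ ℓ, u' m = fun j => C a * u m j) :
    rkStage c d τ L u' ℓ = fun j => C a * rkStage c d τ L u ℓ j := by
  funext j
  unfold rkStage
  rw [Finset.mul_sum]
  refine Finset.sum_congr rfl fun m hm => ?_
  have hm' := Nat.lt_succ_iff.1 (Finset.mem_range.1 hm)
  rw [hu' m hm', hL.map_C_mul hpt (hu m hm')]
  ring

lemma oedg_stages_C_mul [NeZero N] {k s : ℕ} {pt : Fin (N+1) → ℝ} (hpt : IsMesh pt) {β : ℝ}
    {c d : ℕ → ℕ → ℝ} {τ : ℝ} {βc : Fin N → ℝ}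
    {Pc : Fin N → ℕ → Polynomial ℝ → Polynomial ℝ} (hPc : IsCellProj pt Pc)
    {L Fτ : (Fin N → Polynomial ℝ) → (Fin N → Polynomial ℝ)}
    (hL : IsDGOp k pt β L) (hF : IsOEOp k pt βc Pc τ Fτ) {un : Fin N → Polynomial ℝ}
    (hun : MemVk k un) (a : ℝ) {uh uσ uh' uσ' : ℕ → Fin N → Polynomial ℝ}
    (hst : IsOEDGStep s c d τ L Fτ un uh uσ)
    (hst' : IsOEDGStep s c d τ L Fτ (fun j => C a * un j) uh' uσ') (ℓ : ℕ) (hℓ : ℓ ≤ s) :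
    MemVk k (uσ ℓ) ∧ uσ' ℓ = fun j => C a * uσ ℓ j := by
  induction ℓ using Nat.strong_induction_on with
  | _ ℓ ih =>
    rcases ℓ with _ | ℓ
    · rw [hst.1, hst'.1]
      exact ⟨hun, rfl⟩
    · obtain ⟨h₁, h₂⟩ := hst.2 ℓ hℓ
      obtain ⟨h₁', h₂'⟩ := hst'.2 ℓ hℓ
      have ih' := fun m (hm : m ≤ ℓ) => ih m (by omega) (by omega)
      have hmem := memVk_rkStage c d τ hL fun m hm => (ih' m hm).1
      rw [h₂, h₂', h₁, h₁', rkStage_C_mul hpt c d τ hL (fun m hm => (ih' m hm).1) a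
        fun m hm => (ih' m hm).2]
      exact ⟨hF.memVk hmem, hF.map_C_mul hpt hPc hmem a⟩

/-- Theorem 2.2: homogeneity of the OEDG solution operator for the
linear advection equation with upwind flux.  If `uσ, uh` is the OEDG evolution with
initial data `u0` and `uσ', uh'` is the OEDG evolution with initial data `λ u0`, then
`u_σ'^n = λ u_σ^n` for every `λ ∈ ℝ` and every `n ≥ 0`, i.e. `E_n(λu⁰) = λ E_n(u⁰)`. -/
theorem oedg_homogeneous
    {N : ℕ} [NeZero N] (k s : ℕ) (hs : 1 ≤ s) (pt : Fin (N+1) → ℝ) (hpt : IsMesh pt)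
    (β : ℝ) (hβ : 0 < β)
    (c d : ℕ → ℕ → ℝ) (hc : ∀ ℓ < s, ∑ m ∈ Finset.range (ℓ+1), c ℓ m = 1)
    (τ : ℝ) (hτ : 0 < τ)
    (Pc : Fin N → ℕ → Polynomial ℝ → Polynomial ℝ) (hPc : IsCellProj pt Pc)
    (L Fτ : (Fin N → Polynomial ℝ) → (Fin N → Polynomial ℝ))
    (hL : IsDGOp k pt β L) (hFτ : IsOEOp k pt (fun _ => β) Pc τ Fτ)
    (u0 : Fin N → Polynomial ℝ) (hu0 : MemVk k u0) (lam : ℝ)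
    (uh uσ uh' uσ' : ℕ → ℕ → Fin N → Polynomial ℝ)
    (hev : IsOEDGEvol s c d τ L Fτ u0 uh uσ)
    (hev' : IsOEDGEvol s c d τ L Fτ (fun j => Polynomial.C lam * u0 j) uh' uσ') :
    ∀ n : ℕ, uσ' n 0 = fun j => Polynomial.C lam * uσ n 0 j := by
  suffices h : ∀ n, MemVk k (uσ n 0) ∧ uσ' n 0 = fun j => C lam * uσ n 0 j from fun n => (h n).2
  intro n
  induction n with
  | zero => exact ⟨hev.1 ▸ hu0, by rw [hev.1, hev'.1]⟩
  | succ n ih =>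
    rw [(hev.2 n).1, (hev'.2 n).1]
    exact oedg_stages_C_mul hpt hPc hL hFτ ih.1 lam ⟨rfl, (hev.2 n).2⟩ ⟨ih.2, (hev'.2 n).2⟩ s le_rfl
end OEDG
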